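/- For every n ≥ 1, the number of permutations of length n avoiding all four patterns 2431, 4231, 1432 and 4132 equals the central binomial coefficient C(2(n-1), n-1). -/

import Mathlib

/-- A permutation `τ` of `Fin n` contains the pattern given by `p : Fin k → ℕ`
if some subsequence of `τ` is order-isomorphic to `p`. -/
def Contains {n k : ℕ} (τ : Equiv.Perm (Fin n)) (p : Fin k → ℕ) : Prop :=
  ∃ f : Fin k → Fin n, StrictMono f ∧ ∀ a b, p a < p b ↔ τ (f a) < τ (f b)

def AvoidsPat {n k : ℕ} (τ : Equiv.Perm (Fin n)) (p : Fin k → ℕ) : Prop := ¬ Contains τ p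

open Finset

/-- The entry at position `i` is neither a left-to-right minimum nor a left-to-right maximum. -/
def NonExtremal {n : ℕ} (τ : Equiv.Perm (Fin n)) (i : Fin n) : Prop :=
  (∃ j < i, τ j < τ i) ∧ ∃ j < i, τ i < τ j

/-- Every entry is a left-to-right minimum, a left-to-right maximum or a right-to-left minimum. -/
def IsGood {n : ℕ} (τ : Equiv.Perm (Fin n)) : Prop :=
  ∀ i, NonExtremal τ i → ∀ j, i < j → τ i < τ j

theorem contains_four {n : ℕ} {τ : Equiv.Perm (Fin n)} {p : Fin 4 → ℕ} {a b c d : Fin n}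
    (hab : a < b) (hbc : b < c) (hcd : c < d)
    (h : ∀ x y, p x < p y ↔ τ (![a, b, c, d] x) < τ (![a, b, c, d] y)) : Contains τ p := by
  refine ⟨![a, b, c, d], ?_, h⟩
  rw [Fin.strictMono_iff_lt_succ]
  intro i
  fin_cases i <;> simpa

theorem avoids_iff_isGood {n : ℕ} (τ : Equiv.Perm (Fin n)) :
    (AvoidsPat τ ![2,4,3,1] ∧ AvoidsPat τ ![4,2,3,1] ∧
      AvoidsPat τ ![1,4,3,2] ∧ AvoidsPat τ ![4,1,3,2]) ↔ IsGood τ := by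
  constructor
  · rintro ⟨h1, h2, h3, h4⟩ i ⟨⟨s, hs, hsi⟩, l, hl, hil⟩ k hk
    by_contra! hle
    have hki : τ k < τ i := lt_of_le_of_ne hle fun h => hk.ne' (τ.injective h)
    have hsk : τ s ≠ τ k := fun h => (hs.trans hk).ne (τ.injective h)
    have hsl : s ≠ l := by rintro rfl; exact lt_asymm hsi hil
    rcases lt_or_gt_of_ne hsl with hsl | hsl <;> rcases lt_or_gt_of_ne hsk with hsk | hsk
    · refine h3 (contains_four hsl hl hk fun x y => ?_)
      fin_cases x <;> fin_cases y <;> simp <;> order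
    · refine h1 (contains_four hsl hl hk fun x y => ?_)
      fin_cases x <;> fin_cases y <;> simp <;> order
    · refine h4 (contains_four hsl hs hk fun x y => ?_)
      fin_cases x <;> fin_cases y <;> simp <;> order
    · refine h2 (contains_four hsl hs hk fun x y => ?_)
      fin_cases x <;> fin_cases y <;> simp <;> order
  · intro hg
    refine ⟨?_, ?_, ?_, ?_⟩ <;> rintro ⟨f, hf, h⟩
    · exact lt_asymm ((h 3 2).1 (by decide)) (hg (f 2)
        ⟨⟨f 0, hf (by decide), (h 0 2).1 (by decide)⟩,
          f 1, hf (by decide), (h 2 1).1 (by decide)⟩ (f 3) (hf (by decide)))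
    · exact lt_asymm ((h 3 2).1 (by decide)) (hg (f 2)
        ⟨⟨f 1, hf (by decide), (h 1 2).1 (by decide)⟩,
          f 0, hf (by decide), (h 2 0).1 (by decide)⟩ (f 3) (hf (by decide)))
    · exact lt_asymm ((h 3 2).1 (by decide)) (hg (f 2)
        ⟨⟨f 0, hf (by decide), (h 0 2).1 (by decide)⟩,
          f 1, hf (by decide), (h 2 1).1 (by decide)⟩ (f 3) (hf (by decide)))
    · exact lt_asymm ((h 3 2).1 (by decide)) (hg (f 2)
        ⟨⟨f 1, hf (by decide), (h 1 2).1 (by decide)⟩,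
          f 0, hf (by decide), (h 2 0).1 (by decide)⟩ (f 3) (hf (by decide)))

/-- Append the last entry `v` to `σ`, raising the entries of `σ` that are at least `v`. -/
def appendLast {n : ℕ} (v : Fin (n + 1)) (σ : Equiv.Perm (Fin n)) : Equiv.Perm (Fin (n + 1)) :=
  (finSuccEquiv' (Fin.last n)).trans ((Equiv.optionCongr σ).trans (finSuccEquiv' v).symm)

@[simp] theorem appendLast_last {n : ℕ} (v : Fin (n + 1)) (σ : Equiv.Perm (Fin n)) :
    appendLast v σ (Fin.last n) = v := by
  simp [appendLast]

@[simp] theorem appendLast_castSucc {n : ℕ} (v : Fin (n + 1)) (σ : Equiv.Perm (Fin n))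
    (i : Fin n) : appendLast v σ i.castSucc = v.succAbove (σ i) := by
  simp [appendLast, finSuccEquiv'_last_apply_castSucc]

theorem appendLast_bijective (n : ℕ) :
    Function.Bijective fun x : Fin (n + 1) × Equiv.Perm (Fin n) => appendLast x.1 x.2 := by
  rw [Fintype.bijective_iff_injective_and_card]
  refine ⟨?_, by simp [Fintype.card_perm, Nat.factorial_succ]⟩
  rintro ⟨v, σ⟩ ⟨w, ρ⟩ h
  have hv : v = w := by simpa using DFunLike.congr_fun h (Fin.last n)
  subst hv
  have hσ : σ = ρ := by
    ext i : 1
    simpa using DFunLike.congr_fun h i.castSucc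
  rw [hσ]

theorem nonExtremal_appendLast_castSucc {n : ℕ} (v : Fin (n + 1)) (σ : Equiv.Perm (Fin n))
    (i : Fin n) : NonExtremal (appendLast v σ) i.castSucc ↔ NonExtremal σ i := by
  simp [NonExtremal, Fin.exists_fin_succ', (Fin.castSucc_lt_last i).not_gt]

theorem nonExtremal_appendLast_last {n : ℕ} (v : Fin (n + 1)) (σ : Equiv.Perm (Fin n)) :
    NonExtremal (appendLast v σ) (Fin.last n) ↔ 0 < (v : ℕ) ∧ (v : ℕ) < n := by
  simp only [NonExtremal, Fin.exists_fin_succ', appendLast_last, appendLast_castSucc, lt_irrefl,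
    false_and, or_false, Fin.castSucc_lt_last, true_and, Fin.succAbove_lt_iff_castSucc_lt,
    Fin.lt_succAbove_iff_le_castSucc]
  constructor
  · rintro ⟨⟨a, ha⟩, b, hb⟩
    simp only [Fin.lt_def, Fin.le_def, Fin.val_castSucc] at ha hb
    omega
  · rintro ⟨h0, hn⟩
    exact ⟨⟨σ.symm ⟨0, by omega⟩, by rw [Equiv.apply_symm_apply]; exact h0⟩,
      σ.symm ⟨v, hn⟩, by simp⟩

open Classical in
/-- The least strict upper bound for the values of the non-extremal entries. -/
noncomputable def bound {n : ℕ} (τ : Equiv.Perm (Fin n)) : ℕ :=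
  (univ.filter (NonExtremal τ)).sup fun i => (τ i : ℕ) + 1

theorem bound_le_iff {n : ℕ} (τ : Equiv.Perm (Fin n)) (k : ℕ) :
    bound τ ≤ k ↔ ∀ i, NonExtremal τ i → (τ i : ℕ) < k := by
  simp [bound, Finset.sup_le_iff]

theorem bound_le {n : ℕ} (τ : Equiv.Perm (Fin n)) : bound τ ≤ n :=
  (bound_le_iff τ n).2 fun i _ => (τ i).2

theorem isGood_appendLast_iff {n : ℕ} (v : Fin (n + 1)) (σ : Equiv.Perm (Fin n)) :
    IsGood (appendLast v σ) ↔ IsGood σ ∧ bound σ ≤ v := by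
  simp only [bound_le_iff, IsGood, Fin.forall_fin_succ', nonExtremal_appendLast_castSucc,
    Fin.castSucc_lt_castSucc_iff, appendLast_castSucc, appendLast_last,
    Fin.succAbove_lt_succAbove_iff, Fin.castSucc_lt_last, Fin.succAbove_lt_iff_castSucc_lt,
    (Fin.castSucc_lt_last _).not_gt, lt_irrefl, forall_true_left, false_imp_iff, implies_true,
    and_true]
  simp only [Fin.lt_def, Fin.val_castSucc]
  exact ⟨fun h => ⟨fun i hi => (h i hi).1, fun i hi => (h i hi).2⟩,
    fun h i hi => ⟨h.1 i hi, h.2 i hi⟩⟩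

theorem bound_appendLast {n : ℕ} (v : Fin (n + 1)) (σ : Equiv.Perm (Fin n)) (h : bound σ ≤ v) :
    bound (appendLast v σ) = if 0 < (v : ℕ) ∧ (v : ℕ) < n then (v : ℕ) + 1 else bound σ := by
  have hval : ∀ i, NonExtremal σ i → (v.succAbove (σ i) : ℕ) = σ i := fun i hi => by
    rw [Fin.succAbove_of_castSucc_lt _ _ (by simpa [Fin.lt_def] using (bound_le_iff σ v).1 h i hi)]
    rfl
  refine eq_of_forall_ge_iff fun k => ?_
  have hk : bound (appendLast v σ) ≤ k ↔
      bound σ ≤ k ∧ (0 < (v : ℕ) ∧ (v : ℕ) < n → (v : ℕ) < k) := by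
    rw [bound_le_iff, bound_le_iff, Fin.forall_fin_succ', nonExtremal_appendLast_last,
      appendLast_last]
    refine and_congr_left' (forall_congr' fun i => ?_)
    rw [nonExtremal_appendLast_castSucc, appendLast_castSucc]
    exact forall_congr' fun hi => by rw [hval i hi]
  rw [hk]
  split_ifs with hv
  · simp only [hv, and_self, forall_true_left]
    omega
  · simp only [hv, false_imp_iff, and_true]

/-- The number of nodes `m` levels below the label `a` in the generating tree with rule
`a ↦ 2, 3, …, a + 1`. -/
def ballot : ℕ → ℕ → ℕ
  | 0, _ => 1
  | m + 1, a => ∑ b ∈ range a, ballot m (b + 2)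

theorem ballot_one (a : ℕ) : ballot 1 a = a := by simp [ballot]

theorem ballot_succ_succ (m a : ℕ) :
    ballot (m + 1) (a + 1) = ballot (m + 1) a + ballot m (a + 2) := by
  simp [ballot, sum_range_succ]

theorem ballot_add_choose (m a : ℕ) :
    ballot (m + 2) a + (2 * m + a + 2).choose m = (2 * m + a + 2).choose (m + 2) := by
  induction m generalizing a with
  | zero =>
    induction a with
    | zero => simp [ballot]
    | succ a ih =>
      rw [ballot_succ_succ, ballot_one]
      have h := Nat.choose_succ_succ (a + 2) 1
      simp only [Nat.succ_eq_add_one, Nat.choose_one_right, Nat.choose_zero_right, mul_zero,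
        zero_add, Nat.reduceAdd] at *
      rw [show a + 1 + 2 = a + 2 + 1 by ring]
      omega
  | succ m ihm =>
    induction a with
    | zero =>
      simp only [ballot, range_zero, sum_empty, zero_add]
      exact Nat.choose_symm_of_eq_add (by ring)
    | succ a ih =>
      rw [ballot_succ_succ]
      have h := ihm (a + 2)
      have h1 := Nat.choose_succ_succ (2 * (m + 1) + a + 2) (m + 2)
      have h2 := Nat.choose_succ_succ (2 * (m + 1) + a + 2) m
      rw [show 2 * (m + 1) + (a + 1) + 2 = 2 * (m + 1) + a + 2 + 1 by ring,
        show m + 1 + 2 = m + 2 + 1 by ring, show m + 1 + 1 = m + 2 by ring]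
      rw [show 2 * m + (a + 2) + 2 = 2 * (m + 1) + a + 2 by ring] at h
      simp only [Nat.succ_eq_add_one] at h1 h2
      rw [show m + 1 + 2 = m + 2 + 1 by ring] at ih
      omega

theorem choose_eq_two_mul_add_ballot (m k : ℕ) :
    (2 * (m + 1) + k).choose (m + 1) = 2 * (2 * m + (k + 1)).choose m + ballot (m + 1) k := by
  cases m with
  | zero => simp [ballot_one]
  | succ m =>
    have h := ballot_add_choose m k
    have h1 := Nat.choose_succ_succ (2 * m + k + 3) (m + 1)
    have h2 := Nat.choose_succ_succ (2 * m + k + 2) (m + 1)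
    have h3 := Nat.choose_succ_succ (2 * m + k + 2) m
    simp only [Nat.succ_eq_add_one, add_assoc, Nat.reduceAdd] at *
    rw [show 2 * (m + 2) + k = 2 * m + (k + 4) by ring,
      show 2 * (m + 1) + (k + 1) = 2 * m + (k + 3) by ring]
    omega

/-- The number of good extensions, by `m` further entries, of a good permutation of length `n`
with bound `k`. -/
def extensionCount (m n k : ℕ) : ℕ :=
  if k = 0 then (2 * m + (n - 1)).choose m else ballot m (n + 1 - k)

theorem sum_Ico_ballot (m n k : ℕ) :
    ∑ v ∈ Ico k n, ballot m (n + 1 - v) = ballot (m + 1) (n - k) := by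
  rw [ballot, ← sum_range_reflect, sum_Ico_eq_sum_range]
  refine sum_congr rfl fun i hi => ?_
  rw [mem_range] at hi
  congr 1
  omega

theorem extensionCount_succ (m n k : ℕ) (hk : k ≤ n + 1) :
    extensionCount (m + 1) (n + 1) k = ∑ v ∈ Ico k (n + 2),
      extensionCount m (n + 2) (if 0 < v ∧ v < n + 1 then v + 1 else k) := by
  rw [sum_Ico_succ_top hk]
  have hmid : ∀ j, 0 < j → ∑ v ∈ Ico j (n + 1),
      extensionCount m (n + 2) (if 0 < v ∧ v < n + 1 then v + 1 else k) =
        ballot (m + 1) (n + 1 - j) := fun j hj => by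
    rw [← sum_Ico_ballot]
    refine sum_congr rfl fun v hv => ?_
    rw [mem_Ico] at hv
    rw [if_pos (by omega), extensionCount, if_neg (by omega)]
    congr 1
    omega
  rcases Nat.eq_zero_or_pos k with rfl | hpos
  · rw [sum_eq_sum_Ico_succ_bot (by omega), hmid _ (by omega)]
    have h := choose_eq_two_mul_add_ballot m n
    simp only [extensionCount, lt_irrefl, false_and, and_false, if_false, if_true,
      Nat.add_sub_cancel, zero_add, show n + 2 - 1 = n + 1 by omega]
    omega
  · rw [hmid k hpos]
    simp only [extensionCount, lt_irrefl, and_false, if_false, if_neg hpos.ne',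
      show n + 1 + 1 - k = n + 1 - k + 1 by omega, show n + 2 + 1 - k = n + 1 - k + 2 by omega,
      ballot_succ_succ]

open Classical in
theorem sum_isGood_succ (n : ℕ) (f : ℕ → ℕ) :
    ∑ τ : Equiv.Perm (Fin (n + 1)) with IsGood τ, f (bound τ) =
      ∑ σ : Equiv.Perm (Fin n) with IsGood σ, ∑ v ∈ Ico (bound σ) (n + 1),
        f (if 0 < v ∧ v < n then v + 1 else bound σ) := by
  rw [sum_filter, ← (appendLast_bijective n).sum_comp, Fintype.sum_prod_type_right, sum_filter]
  refine sum_congr rfl fun σ _ => ?_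
  simp only [isGood_appendLast_iff]
  split_ifs with hσ
  · simp only [hσ, true_and]
    have hIco : Ico (bound σ) (n + 1) = (range (n + 1)).filter (bound σ ≤ ·) := by
      ext v
      simp [and_comm]
    rw [hIco, sum_filter, ← Fin.sum_univ_eq_sum_range
      (fun v => if bound σ ≤ v then f (if 0 < v ∧ v < n then v + 1 else bound σ) else 0)]
    refine sum_congr rfl fun v _ => ?_
    by_cases h : bound σ ≤ v
    · rw [if_pos h, if_pos h, bound_appendLast v σ h]
    · rw [if_neg h, if_neg h]
  · simp [hσ]

open Classical in
theorem sum_extensionCount (n m : ℕ) :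
    ∑ τ : Equiv.Perm (Fin (n + 1)) with IsGood τ, extensionCount m (n + 1) (bound τ) =
      (2 * (n + m)).choose (n + m) := by
  induction n generalizing m with
  | zero =>
    have hne : ∀ (τ : Equiv.Perm (Fin 1)) i, ¬ NonExtremal τ i := by
      rintro τ i ⟨⟨j, hj, -⟩, -⟩
      exact hj.ne (Subsingleton.elim _ _)
    have hg : ∀ τ : Equiv.Perm (Fin 1), IsGood τ := fun τ i hi => absurd hi (hne τ i)
    have hb : ∀ τ : Equiv.Perm (Fin 1), bound τ = 0 := fun τ =>
      Nat.le_zero.1 ((bound_le_iff τ 0).2 fun i hi => absurd hi (hne τ i))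
    simp [hg, hb, extensionCount]
  | succ n ih =>
    rw [sum_isGood_succ (n + 1) (extensionCount m (n + 2)),
      show n + 1 + m = n + (m + 1) by ring, ← ih (m + 1)]
    exact sum_congr rfl fun σ _ => (extensionCount_succ m n _ (bound_le σ)).symm

theorem stmt0 (n : ℕ) (hn : 1 ≤ n) :
    Nat.card {τ : Equiv.Perm (Fin n) //
      AvoidsPat τ ![2,4,3,1] ∧ AvoidsPat τ ![4,2,3,1] ∧
      AvoidsPat τ ![1,4,3,2] ∧ AvoidsPat τ ![4,1,3,2]} =
    Nat.choose (2 * (n - 1)) (n - 1) := by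
  classical
  obtain ⟨n, rfl⟩ := Nat.exists_eq_add_of_le' hn
  simp only [avoids_iff_isGood]
  rw [Nat.card_eq_fintype_card, Fintype.card_subtype, card_eq_sum_ones]
  simpa [extensionCount, ballot] using sum_extensionCount n 0
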